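/- ODE core of Proposition 1.3 (positivity propagation and blow-up estimate for the localized average): Let β ∈ [-1,1], p > 1, γ > 0 and T₀ > 0. Let b satisfy the damping assumptions with constants b₁, b₂, b₃, and if β > 0 assume additionally that B⁻¹(τ) ≤ B₄(1+τ)^{1/(1+β)} for all τ ≥ 0 for some constant B₄ > 0. Let J : [0,T₀) → ℝ be twice continuously differentiable with J(0) > 0, J'(0) > 0, and γ J(0)^{p−1} ≤ 1, and assume that for every t₁ ∈ (0,T₀], if J(s) > 0 for all s ∈ [0,t₁), then J''(s) + b(s) J'(s) ≥ γ J(s)^p for all s ∈ [0,t₁). Set A₁ = J'(0)/J(0), δ₀ = γ^{1/(p−1)} J(0), and μ = μ(p,b,β,A₁). Then J(t) > 0 for all t ∈ [0,T₀), J(t) ≥ J(0) (1 − μ δ₀^{p−1} B(t))^{−2/(p−1)} for all t ∈ [0,T₀), and T₀ ≤ B⁻¹(μ⁻¹ δ₀^{1−p}). -/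

import Mathlib

open Set

/-- The constant μ(p,b,β,A) from the paper, where `b0 = b(0)` and
`K = (2^{1/(1+β)}(1+B₄))^{2β}` if `β > 0` and `K = 1` if `β ≤ 0`. -/
noncomputable def dampMu (p b0 β b₁ b₃ B₄ A : ℝ) : ℝ :=
  min 1 (min ((p - 1) / 2 * b0 * A)
    ((2 * (p + 1) / (p - 1) ^ 2 * b₁ ^ (-(2:ℝ)) *
        (if 0 < β then ((2:ℝ) ^ (1 / (1 + β)) * (1 + B₄)) ^ (2 * β) else 1) +
      2 * (b₁⁻¹ * b₃ + 1) / (p - 1))⁻¹))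

/-- A function whose derivative starts out positive, and which satisfies `f'' + b f' ≥ 0` as long as
it stays positive, has a positive derivative throughout. -/
lemma deriv_pos_of_damped_inequality {T : ℝ} {b f f' f'' : ℝ → ℝ}
    (hb : ContinuousOn b (Icc 0 T))
    (hf : ∀ t ∈ Icc 0 T, HasDerivWithinAt f (f' t) (Icc 0 T) t)
    (hf' : ∀ t ∈ Icc 0 T, HasDerivWithinAt f' (f'' t) (Icc 0 T) t)
    (h0 : 0 ≤ f 0) (h0' : 0 < f' 0)
    (H : ∀ t₁ ∈ Ioc 0 T, (∀ s ∈ Ioo 0 t₁, 0 < f s) → ∀ s ∈ Ioo 0 t₁, 0 ≤ f'' s + b s * f' s) :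
    ∀ t ∈ Icc 0 T, 0 < f' t := by
  by_contra! hcon
  obtain ⟨t, ht, hft⟩ := hcon
  set Z : Set ℝ := Icc 0 T ∩ f' ⁻¹' Iic 0
  have hZc : IsClosed Z :=
    ContinuousOn.preimage_isClosed_of_isClosed (fun x hx => (hf' x hx).continuousWithinAt)
      isClosed_Icc isClosed_Iic
  have hZb : BddBelow Z := ⟨0, fun x hx => hx.1.1⟩
  obtain ⟨⟨hS0, hST⟩, hS⟩ : sInf Z ∈ Z := hZc.csInf_mem ⟨t, ht, hft⟩ hZb
  set S := sInf Z
  rw [mem_preimage, mem_Iic] at hS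
  have hSpos : 0 < S := by
    rcases hS0.eq_or_lt with h | h
    · rw [← h] at hS
      exact absurd h0' hS.not_gt
    · exact h
  have hpos : ∀ r, 0 ≤ r → r < S → 0 < f' r := by
    intro r hr hrS
    by_contra! hneg
    exact hrS.not_ge (csInf_le hZb ⟨⟨hr, hrS.le.trans hST⟩, hneg⟩)
  have hsub : Icc 0 S ⊆ Icc 0 T := Icc_subset_Icc_right hST
  have hmono : StrictMonoOn f (Icc 0 S) := by
    refine strictMonoOn_of_hasDerivWithinAt_pos (f' := f') (convex_Icc 0 S)
      (fun x hx => ((hf x (hsub hx)).mono hsub).continuousWithinAt) ?_ ?_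
    · intro x hx
      exact (hf x (hsub (interior_subset hx))).mono (interior_subset.trans hsub)
    · intro x hx
      rw [interior_Icc] at hx
      exact hpos x hx.1.le hx.2
  have hfpos : ∀ s ∈ Ioo 0 S, 0 < f s := fun s hs =>
    h0.trans_lt (hmono ⟨le_rfl, hSpos.le⟩ ⟨hs.1.le, hs.2.le⟩ hs.1)
  obtain ⟨C, hC⟩ := isCompact_Icc.bddAbove_image hb
  have hexp : ∀ x, HasDerivAt (fun x => Real.exp (C * x)) (Real.exp (C * x) * C) x := fun x => by
    simpa using ((hasDerivAt_id x).const_mul C).exp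
  have hder : ∀ x ∈ Icc 0 T, HasDerivWithinAt (fun x => Real.exp (C * x) * f' x)
      (Real.exp (C * x) * C * f' x + Real.exp (C * x) * f'' x) (Icc 0 T) x :=
    fun x hx => (hexp x).hasDerivWithinAt.mul (hf' x hx)
  have hg : MonotoneOn (fun x => Real.exp (C * x) * f' x) (Icc 0 S) := by
    refine monotoneOn_of_hasDerivWithinAt_nonneg (convex_Icc 0 S)
      (fun x hx => ((hder x (hsub hx)).mono hsub).continuousWithinAt)
      (fun x hx => (hder x (hsub (interior_subset hx))).mono (interior_subset.trans hsub)) ?_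
    intro x hx
    rw [interior_Icc] at hx
    have h1 := H S ⟨hSpos, hST⟩ hfpos x hx
    have h2 : b x ≤ C := hC ⟨x, hsub ⟨hx.1.le, hx.2.le⟩, rfl⟩
    have h3 := mul_le_mul_of_nonneg_right h2 (hpos x hx.1.le hx.2).le
    have h4 : 0 ≤ C * f' x + f'' x := by linarith
    have h5 := mul_nonneg (Real.exp_pos (C * x)).le h4
    linarith
  have h := hg ⟨le_rfl, hSpos.le⟩ ⟨hSpos.le, le_rfl⟩ hSpos.le
  simp only [mul_zero, Real.exp_zero, one_mul] at h
  have := mul_nonneg (Real.exp_pos (C * S)).le (neg_nonneg.2 hS)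
  linarith

/-- A function with positive derivative on `[0, T]` increases strictly from its initial value. -/
lemma lt_of_deriv_pos_Icc {T : ℝ} {f f' : ℝ → ℝ}
    (hf : ∀ t ∈ Icc 0 T, HasDerivWithinAt f (f' t) (Icc 0 T) t)
    (hpos : ∀ t ∈ Icc 0 T, 0 < f' t) (hT : 0 < T) : f 0 < f T := by
  have hmono : StrictMonoOn f (Icc 0 T) :=
    strictMonoOn_of_hasDerivWithinAt_pos (f' := f') (convex_Icc 0 T)
      (fun x hx => (hf x hx).continuousWithinAt)
      (fun x hx => (hf x (interior_subset hx)).mono interior_subset)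
      (fun x hx => hpos x (interior_subset hx))
  exact hmono ⟨le_rfl, hT.le⟩ ⟨hT.le, le_rfl⟩ hT

lemma mul_one_add_rpow_le {β B₄ m t : ℝ} (hβ : β ≤ 1) (hB₄ : 0 < B₄) (hm : 0 < m)
    (hm1 : m ≤ 1) (ht : 0 ≤ t) (hbd : 0 < β → t ≤ B₄ * (1 + m⁻¹) ^ (1 / (1 + β))) :
    m * (1 + t) ^ (2 * β) ≤
      if 0 < β then ((2:ℝ) ^ (1 / (1 + β)) * (1 + B₄)) ^ (2 * β) else 1 := by
  split_ifs with h
  · have hm1' : 1 ≤ m⁻¹ := (one_le_inv₀ hm).2 hm1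
    have he : 0 ≤ 1 / (1 + β) := by positivity
    have h1 : (1 + m⁻¹) ^ (1 / (1 + β)) ≤ (2 * m⁻¹) ^ (1 / (1 + β)) :=
      Real.rpow_le_rpow (by positivity) (by linarith) he
    have h2 : 1 ≤ (2 * m⁻¹) ^ (1 / (1 + β)) := Real.one_le_rpow (by linarith) he
    have h3 : 1 + t ≤ (1 + B₄) * (2 * m⁻¹) ^ (1 / (1 + β)) := by
      have := (hbd h).trans (mul_le_mul_of_nonneg_left h1 hB₄.le)
      linarith
    rw [Real.mul_rpow (by norm_num) (by positivity)] at h3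
    have h4 : (1 + t) ^ (2 * β) ≤
        (((2:ℝ) ^ (1 / (1 + β)) * (1 + B₄)) * m⁻¹ ^ (1 / (1 + β))) ^ (2 * β) :=
      Real.rpow_le_rpow (by positivity) (by linarith) (by positivity)
    rw [Real.mul_rpow (by positivity) (by positivity), ← Real.rpow_mul (by positivity)] at h4
    have h5 : (m⁻¹) ^ (1 / (1 + β) * (2 * β)) ≤ m⁻¹ := by
      have : 1 / (1 + β) * (2 * β) ≤ 1 := by
        rw [one_div_mul_eq_div, div_le_one (by positivity)]
        linarith
      simpa using Real.rpow_le_rpow_of_exponent_le hm1' this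
    have hK : 0 ≤ ((2:ℝ) ^ (1 / (1 + β)) * (1 + B₄)) ^ (2 * β) := by positivity
    calc m * (1 + t) ^ (2 * β)
        ≤ m * (((2:ℝ) ^ (1 / (1 + β)) * (1 + B₄)) ^ (2 * β) * m⁻¹) :=
          mul_le_mul_of_nonneg_left (h4.trans (mul_le_mul_of_nonneg_left h5 hK)) hm.le
      _ = _ := by field_simp
  · have := Real.rpow_le_one_of_one_le_of_nonpos (by linarith : 1 ≤ 1 + t)
      (by linarith : 2 * β ≤ 0)
    exact mul_le_one₀ hm1 (by positivity) this

lemma dampMu_pos {p b0 β b₁ b₃ B₄ A : ℝ} (hp : 1 < p) (hb0 : 0 < b0) (hb₁ : 0 < b₁)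
    (hb₃ : 0 < b₃) (hB₄ : 0 < B₄) (hA : 0 < A) : 0 < dampMu p b0 β b₁ b₃ B₄ A := by
  have hp' : 0 < p - 1 := by linarith
  have hK : 0 < if 0 < β then ((2:ℝ) ^ (1 / (1 + β)) * (1 + B₄)) ^ (2 * β) else 1 := by
    split_ifs <;> positivity
  unfold dampMu
  refine lt_min one_pos (lt_min (by positivity) (by positivity))

/-- The coefficient inequality which makes `J 0 * (1 - m * B) ^ (-(2 / (p - 1)))` a subsolution. -/
lemma subsolution_coeff_le {p β b₁ b₃ B₄ b0 A ε m t c c' x : ℝ} (hp : 1 < p)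
    (hβ : β ≤ 1) (hb₁ : 0 < b₁) (hb₃ : 0 < b₃) (hB₄ : 0 < B₄)
    (hε : 0 < ε) (hε1 : ε ≤ 1) (hm : 0 < m) (hmε : m ≤ dampMu p b0 β b₁ b₃ B₄ A * ε)
    (ht : 0 ≤ t) (hbd : 0 < β → t ≤ B₄ * (1 + m⁻¹) ^ (1 / (1 + β)))
    (hc : b₁ * (1 + t) ^ (-β) ≤ c) (hc' : |c'| ≤ b₃ * (1 + t)⁻¹ * c)
    (hx : 0 < x) (hx1 : x ≤ 1) :
    2 / (p - 1) * (2 / (p - 1) + 1) * m ^ 2 * (c⁻¹) ^ 2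
      - 2 / (p - 1) * m * c' * (c⁻¹) ^ 2 * x + 2 / (p - 1) * m * x ≤ ε := by
  have hp' : 0 < p - 1 := by linarith
  have h1t : 0 < 1 + t := by linarith
  have hcpos : 0 < c := lt_of_lt_of_le (by positivity) hc
  have hm1 : m ≤ 1 := hmε.trans
    ((mul_le_mul_of_nonneg_right (min_le_left _ _) hε.le).trans (by linarith))
  have hK := mul_one_add_rpow_le hβ hB₄ hm hm1 ht hbd
  have hKpos : 0 < if 0 < β then ((2:ℝ) ^ (1 / (1 + β)) * (1 + B₄)) ^ (2 * β) else 1 := by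
    split_ifs <;> positivity
  have hμ : dampMu p b0 β b₁ b₃ B₄ A ≤ (2 * (p + 1) / (p - 1) ^ 2 * b₁ ^ (-(2:ℝ)) *
        (if 0 < β then ((2:ℝ) ^ (1 / (1 + β)) * (1 + B₄)) ^ (2 * β) else 1) +
      2 * (b₁⁻¹ * b₃ + 1) / (p - 1))⁻¹ := (min_le_right _ _).trans (min_le_right _ _)
  set K : ℝ := if 0 < β then ((2:ℝ) ^ (1 / (1 + β)) * (1 + B₄)) ^ (2 * β) else 1
  set D := 2 * (p + 1) / (p - 1) ^ 2 * b₁ ^ (-(2:ℝ)) * K + 2 * (b₁⁻¹ * b₃ + 1) / (p - 1) with hD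
  have hDpos : 0 < D := by positivity
  have hmD : m * D ≤ ε := by
    have h1 : m ≤ D⁻¹ * ε := hmε.trans (mul_le_mul_of_nonneg_right hμ hε.le)
    calc m * D ≤ D⁻¹ * ε * D := mul_le_mul_of_nonneg_right h1 hDpos.le
      _ = ε := by field_simp
  have hci : c⁻¹ ≤ b₁⁻¹ * (1 + t) ^ β := by
    have := inv_anti₀ (by positivity) hc
    rwa [mul_inv, Real.rpow_neg h1t.le, inv_inv] at this
  have hb2 : b₁ ^ (-(2:ℝ)) = (b₁⁻¹) ^ 2 := by
    rw [Real.rpow_neg hb₁.le, inv_pow]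
    norm_num
  have hcsq : m * (c⁻¹) ^ 2 ≤ b₁ ^ (-(2:ℝ)) * K := by
    calc m * (c⁻¹) ^ 2 ≤ m * (b₁⁻¹ * (1 + t) ^ β) ^ 2 := by gcongr
      _ = (b₁⁻¹) ^ 2 * (m * (1 + t) ^ (2 * β)) := by
        rw [mul_pow, mul_comm 2 β, Real.rpow_mul h1t.le]
        norm_num
        ring
      _ ≤ b₁ ^ (-(2:ℝ)) * K := by
        rw [hb2]
        gcongr
  have hcder : -(c' * (c⁻¹) ^ 2) ≤ b₁⁻¹ * b₃ := by
    calc -(c' * (c⁻¹) ^ 2) = -c' * (c⁻¹) ^ 2 := by ring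
      _ ≤ b₃ * (1 + t)⁻¹ * c * (c⁻¹) ^ 2 := by
        gcongr
        exact (neg_le_abs c').trans hc'
      _ = b₃ * (1 + t)⁻¹ * c⁻¹ := by field_simp
      _ ≤ b₃ * (1 + t)⁻¹ * (b₁⁻¹ * (1 + t) ^ β) := by gcongr
      _ ≤ b₃ * (1 + t)⁻¹ * (b₁⁻¹ * (1 + t)) := by
        gcongr
        simpa using Real.rpow_le_rpow_of_exponent_le (by linarith : 1 ≤ 1 + t) hβ
      _ = b₁⁻¹ * b₃ := by field_simp
  have hk : 2 / (p - 1) * (2 / (p - 1) + 1) = 2 * (p + 1) / (p - 1) ^ 2 := by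
    field_simp
    ring
  have hfirst : 2 / (p - 1) * (2 / (p - 1) + 1) * m ^ 2 * (c⁻¹) ^ 2 ≤
      m * (2 * (p + 1) / (p - 1) ^ 2 * b₁ ^ (-(2:ℝ)) * K) := by
    rw [hk]
    calc 2 * (p + 1) / (p - 1) ^ 2 * m ^ 2 * (c⁻¹) ^ 2
        = m * (2 * (p + 1) / (p - 1) ^ 2) * (m * (c⁻¹) ^ 2) := by ring
      _ ≤ m * (2 * (p + 1) / (p - 1) ^ 2) * (b₁ ^ (-(2:ℝ)) * K) := by gcongr
      _ = _ := by ring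
  have hsecond : 2 / (p - 1) * m * x * (-(c' * (c⁻¹) ^ 2) + 1) ≤
      m * (2 * (b₁⁻¹ * b₃ + 1) / (p - 1)) := by
    calc 2 / (p - 1) * m * x * (-(c' * (c⁻¹) ^ 2) + 1)
        ≤ 2 / (p - 1) * m * x * (b₁⁻¹ * b₃ + 1) := by gcongr
      _ ≤ 2 / (p - 1) * m * 1 * (b₁⁻¹ * b₃ + 1) := by gcongr
      _ = _ := by ring
  have : m * D = m * (2 * (p + 1) / (p - 1) ^ 2 * b₁ ^ (-(2:ℝ)) * K) +
      m * (2 * (b₁⁻¹ * b₃ + 1) / (p - 1)) := by rw [hD]; ring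
  linarith

/-- The primitive of the reciprocal of a positive continuous function on `[0, ∞)`. -/
lemma hasDerivWithinAt_primitive_inv {b B : ℝ → ℝ} (hb : ContinuousOn b (Ici 0))
    (hbpos : ∀ t ≥ (0:ℝ), 0 < b t) (hB : ∀ t ≥ (0:ℝ), B t = ∫ τ in (0:ℝ)..t, (b τ)⁻¹)
    {t : ℝ} (ht : 0 ≤ t) : HasDerivWithinAt B (b t)⁻¹ (Ici 0) t := by
  have hcont : Continuous fun x : ℝ => (b (max x 0))⁻¹ :=
    (hb.comp_continuous (continuous_id.max continuous_const) fun x => mem_Ici.2 (le_max_right _ _)).inv₀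
      fun x => (hbpos _ (le_max_right _ _)).ne'
  have h := (hcont.integral_hasStrictDerivAt 0 t).hasDerivAt.hasDerivWithinAt (s := Ici 0)
  rw [max_eq_left ht] at h
  have heq : ∀ u ∈ Ici (0:ℝ), B u = ∫ τ in (0:ℝ)..u, (b (max τ 0))⁻¹ := by
    intro u hu
    rw [hB u hu]
    refine intervalIntegral.integral_congr fun τ hτ => ?_
    rw [uIcc_of_le hu] at hτ
    simp only [max_eq_left hτ.1]
  exact h.congr heq (heq t ht)

/-- Comparison on `[0, T]` with the explicit profile `J 0 * (1 - m * B) ^ (-(2 / (p - 1)))`, when the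
initial slope of `J` is strictly larger than that of the profile. -/
lemma profile_lt_of_damped_inequality {T p γ m : ℝ} {b b' B J J' J'' : ℝ → ℝ}
    (hT : 0 < T) (hp : 1 < p)
    (hbpos : ∀ t ∈ Icc 0 T, 0 < b t)
    (hb : ∀ t ∈ Icc 0 T, HasDerivWithinAt b (b' t) (Icc 0 T) t)
    (hB : ∀ t ∈ Icc 0 T, HasDerivWithinAt B (b t)⁻¹ (Icc 0 T) t) (hB0 : B 0 = 0)
    (hJ : ∀ t ∈ Icc 0 T, HasDerivWithinAt J (J' t) (Icc 0 T) t)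
    (hJ' : ∀ t ∈ Icc 0 T, HasDerivWithinAt J' (J'' t) (Icc 0 T) t)
    (hJ0 : 0 < J 0) (hγ : 0 < γ)
    (hineq : ∀ t ∈ Icc 0 T, γ * J t ^ p ≤ J'' t + b t * J' t)
    (hx : ∀ t ∈ Icc 0 T, 0 < 1 - m * B t)
    (hcoeff : ∀ t ∈ Icc 0 T, 2 / (p - 1) * (2 / (p - 1) + 1) * m ^ 2 * ((b t)⁻¹) ^ 2
      - 2 / (p - 1) * m * b' t * ((b t)⁻¹) ^ 2 * (1 - m * B t) + 2 / (p - 1) * m * (1 - m * B t)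
      ≤ γ * J 0 ^ (p - 1))
    (hslope : J 0 * (2 / (p - 1) * m * (b 0)⁻¹) < J' 0) :
    J 0 * (1 - m * B T) ^ (-(2 / (p - 1))) < J T := by
  have hp' : 0 < p - 1 := by linarith
  have hkp : -(2 / (p - 1)) * p = -(2 / (p - 1)) - 1 - 1 := by
    field_simp
    ring
  set k := 2 / (p - 1)
  have hk : 0 < k := by positivity
  have hxd : ∀ t ∈ Icc 0 T, HasDerivWithinAt (fun t => 1 - m * B t) (-(m * (b t)⁻¹)) (Icc 0 T) t :=
    fun t ht => ((hB t ht).const_mul m).const_sub 1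
  have hφ : ∀ t ∈ Icc 0 T, HasDerivWithinAt (fun t => J 0 * (1 - m * B t) ^ (-k))
      (J 0 * (k * m * ((b t)⁻¹ * (1 - m * B t) ^ (-k - 1)))) (Icc 0 T) t := by
    intro t ht
    refine (((hxd t ht).rpow_const (p := -k) (Or.inl (hx t ht).ne')).const_mul (J 0)).congr_deriv ?_
    ring
  have hφ' : ∀ t ∈ Icc 0 T, HasDerivWithinAt
      (fun t => J 0 * (k * m * ((b t)⁻¹ * (1 - m * B t) ^ (-k - 1))))
      (J 0 * (k * m * (-b' t * ((b t)⁻¹) ^ 2 * (1 - m * B t) ^ (-k - 1)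
        + (k + 1) * m * ((b t)⁻¹) ^ 2 * (1 - m * B t) ^ (-k - 1 - 1)))) (Icc 0 T) t := by
    intro t ht
    have h1 := (hb t ht).inv (hbpos t ht).ne'
    have h2 := (hxd t ht).rpow_const (p := -k - 1) (Or.inl (hx t ht).ne')
    refine (((h1.mul h2).const_mul (k * m)).const_mul (J 0)).congr_deriv ?_
    simp only [Pi.inv_apply]
    ring
  have hwd : ∀ t ∈ Icc 0 T, HasDerivWithinAt (fun t => J t - J 0 * (1 - m * B t) ^ (-k))
      (J' t - J 0 * (k * m * ((b t)⁻¹ * (1 - m * B t) ^ (-k - 1)))) (Icc 0 T) t :=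
    fun t ht => (hJ t ht).sub (hφ t ht)
  have hpos := deriv_pos_of_damped_inequality (fun t ht => (hb t ht).continuousWithinAt) hwd
    (fun t ht => (hJ' t ht).sub (hφ' t ht)) (by simp [hB0])
    (by simpa [hB0, mul_assoc] using hslope) ?_
  · have h := lt_of_deriv_pos_Icc hwd hpos hT
    simpa [hB0] using h
  · intro t₁ ht₁ hw s hs
    have hsT : s ∈ Icc 0 T := ⟨hs.1.le, hs.2.le.trans ht₁.2⟩
    have hxs := hx s hsT
    have hbs := hbpos s hsT
    have hJφ := hw s hs
    have hcs := hcoeff s hsT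
    have hins := hineq s hsT
    have hpow : (J 0 * (1 - m * B s) ^ (-k)) ^ p ≤ J s ^ p :=
      Real.rpow_le_rpow (by positivity) (by linarith) (by linarith)
    rw [Real.mul_rpow hJ0.le (by positivity), ← Real.rpow_mul hxs.le, hkp] at hpow
    have hJp : J 0 ^ p = J 0 ^ (p - 1) * J 0 := by
      rw [← Real.rpow_add_one hJ0.ne']
      congr 1
      ring
    have hx1 : (1 - m * B s) ^ (-k - 1) = (1 - m * B s) ^ (-k - 1 - 1) * (1 - m * B s) := by
      rw [← Real.rpow_add_one hxs.ne']
      congr 1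
      ring
    rw [hJp] at hpow
    rw [hx1]
    set x := 1 - m * B s
    set y := x ^ (-k - 1 - 1)
    have hy : 0 < y := by positivity
    have h1 := mul_le_mul_of_nonneg_right hcs (mul_pos hJ0 hy).le
    have h2 := mul_le_mul_of_nonneg_left hpow hγ.le
    have h3 : b s * (b s)⁻¹ = 1 := mul_inv_cancel₀ hbs.ne'
    linear_combination h1 + h2 + hins + J 0 * k * m * y * x * h3

/-- ODE core of Proposition 1.3: positivity propagation and blow-up estimate
for the localized average. -/
theorem ode_core_positivity_blowup (β p γ T₀ b₁ b₂ b₃ B₄ : ℝ)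
    (hβ : β ∈ Icc (-1:ℝ) 1) (hp : 1 < p) (hγ : 0 < γ) (hT₀ : 0 < T₀)
    (hb₁ : 0 < b₁) (hb₂ : 0 < b₂) (hb₃ : 0 < b₃) (hB₄ : 0 < B₄)
    (b b' B Binv : ℝ → ℝ)
    (hbpos : ∀ t ≥ (0:ℝ), 0 < b t)
    (hbder : ∀ t ≥ (0:ℝ), HasDerivWithinAt b (b' t) (Ici 0) t)
    (hblow : ∀ t ≥ (0:ℝ), b₁ * (1 + t) ^ (-β) ≤ b t)
    (hbupp : ∀ t ≥ (0:ℝ), b t ≤ b₂ * (1 + t) ^ (-β))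
    (hb'bound : ∀ t ≥ (0:ℝ), |b' t| ≤ b₃ * (1 + t)⁻¹ * b t)
    (hB : ∀ t ≥ (0:ℝ), B t = ∫ τ in (0:ℝ)..t, (b τ)⁻¹)
    (hBmono : StrictMonoOn B (Ici 0))
    (hBinv_left : ∀ t ≥ (0:ℝ), Binv (B t) = t)
    (hBinv_right : ∀ τ ≥ (0:ℝ), 0 ≤ Binv τ ∧ B (Binv τ) = τ)
    (hBinv_bound : 0 < β → ∀ τ ≥ (0:ℝ), Binv τ ≤ B₄ * (1 + τ) ^ (1 / (1 + β)))
    (J J' J'' : ℝ → ℝ)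
    (hJ_der : ∀ t ∈ Ico (0:ℝ) T₀, HasDerivWithinAt J (J' t) (Ico 0 T₀) t)
    (hJ_der2 : ∀ t ∈ Ico (0:ℝ) T₀, HasDerivWithinAt J' (J'' t) (Ico 0 T₀) t)
    (hJ''_cont : ContinuousOn J'' (Ico 0 T₀))
    (hJ0 : 0 < J 0) (hJ'0 : 0 < J' 0) (hsmall : γ * J 0 ^ (p - 1) ≤ 1)
    (hJ_ineq : ∀ t₁ ∈ Ioc (0:ℝ) T₀, (∀ s ∈ Ico (0:ℝ) t₁, 0 < J s) →
      ∀ s ∈ Ico (0:ℝ) t₁, γ * J s ^ p ≤ J'' s + b s * J' s)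
    (A₁ δ₀ μ : ℝ)
    (hA₁ : A₁ = J' 0 / J 0)
    (hδ₀ : δ₀ = γ ^ (1 / (p - 1)) * J 0)
    (hμ : μ = dampMu p (b 0) β b₁ b₃ B₄ A₁) :
    (∀ t ∈ Ico (0:ℝ) T₀, 0 < J t) ∧
    (∀ t ∈ Ico (0:ℝ) T₀,
      J 0 * (1 - μ * δ₀ ^ (p - 1) * B t) ^ (-(2 / (p - 1))) ≤ J t) ∧
    T₀ ≤ Binv (μ⁻¹ * δ₀ ^ (1 - p)) := by
  have hp' : 0 < p - 1 := by linarith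
  have hbc : ContinuousOn b (Ici 0) := fun t ht => (hbder t ht).continuousWithinAt
  have hBder : ∀ t, 0 ≤ t → HasDerivWithinAt B (b t)⁻¹ (Ici 0) t :=
    fun t ht => hasDerivWithinAt_primitive_inv hbc hbpos hB ht
  have hB0 : B 0 = 0 := by simp [hB 0 le_rfl]
  have hBnonneg : ∀ t, 0 ≤ t → 0 ≤ B t := fun t ht => by
    simpa [hB0] using hBmono.monotoneOn self_mem_Ici ht ht
  have hsubJ : ∀ t ∈ Ico 0 T₀, Icc 0 t ⊆ Ico 0 T₀ := fun t ht s hs => ⟨hs.1, hs.2.trans_lt ht.2⟩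
  have hJd : ∀ t ∈ Ico 0 T₀, ∀ s ∈ Icc 0 t, HasDerivWithinAt J (J' s) (Icc 0 t) s :=
    fun t ht s hs => (hJ_der s (hsubJ t ht hs)).mono (hsubJ t ht)
  have hJd' : ∀ t ∈ Ico 0 T₀, ∀ s ∈ Icc 0 t, HasDerivWithinAt J' (J'' s) (Icc 0 t) s :=
    fun t ht s hs => (hJ_der2 s (hsubJ t ht hs)).mono (hsubJ t ht)
  have hJpos : ∀ t ∈ Ico 0 T₀, 0 < J t := by
    intro t ht
    rcases ht.1.eq_or_lt with rfl | htpos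
    · exact hJ0
    refine hJ0.trans (lt_of_deriv_pos_Icc (hJd t ht) (deriv_pos_of_damped_inequality
      (hbc.mono Icc_subset_Ici_self) (hJd t ht) (hJd' t ht) hJ0.le hJ'0 ?_) htpos)
    intro t₁ ht₁ hpos s hs
    have hpos' : ∀ s ∈ Ico 0 t₁, 0 < J s := by
      intro r hr
      rcases hr.1.eq_or_lt with rfl | h
      · exact hJ0
      · exact hpos r ⟨h, hr.2⟩
    refine le_trans ?_ (hJ_ineq t₁ ⟨ht₁.1, ht₁.2.trans ht.2.le⟩ hpos' s ⟨hs.1.le, hs.2⟩)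
    have := hpos s hs
    positivity
  have hineq := hJ_ineq T₀ ⟨hT₀, le_rfl⟩ hJpos
  have hA : 0 < A₁ := hA₁ ▸ div_pos hJ'0 hJ0
  have hb0 : 0 < b 0 := hbpos 0 le_rfl
  have hμpos : 0 < μ := hμ ▸ dampMu_pos hp hb0 hb₁ hb₃ hB₄ hA
  have hδ : δ₀ ^ (p - 1) = γ * J 0 ^ (p - 1) := by
    rw [hδ₀, Real.mul_rpow (by positivity) hJ0.le, ← Real.rpow_mul hγ.le,
      one_div_mul_cancel hp'.ne', Real.rpow_one]
  have hδpos : 0 < δ₀ := by rw [hδ₀]; positivity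
  have hinv : μ⁻¹ * δ₀ ^ (1 - p) = (μ * δ₀ ^ (p - 1))⁻¹ := by
    rw [mul_inv, ← Real.rpow_neg hδpos.le, neg_sub]
  rw [hinv]
  have hεpos : 0 < δ₀ ^ (p - 1) := by positivity
  have hε1 : δ₀ ^ (p - 1) ≤ 1 := hδ ▸ hsmall
  set ε := δ₀ ^ (p - 1)
  set m := μ * ε
  have hm : 0 < m := mul_pos hμpos hεpos
  have hslope : J 0 * (2 / (p - 1) * m * (b 0)⁻¹) ≤ J' 0 := by
    have h1 : μ ≤ (p - 1) / 2 * b 0 * A₁ := by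
      rw [hμ]
      exact (min_le_right _ _).trans (min_le_left _ _)
    have h2 : m ≤ (p - 1) / 2 * b 0 * A₁ := (mul_le_of_le_one_right hμpos.le hε1).trans h1
    calc J 0 * (2 / (p - 1) * m * (b 0)⁻¹)
        ≤ J 0 * (2 / (p - 1) * ((p - 1) / 2 * b 0 * A₁) * (b 0)⁻¹) := by gcongr
      _ = J' 0 := by
        rw [hA₁]
        field_simp
  have hstrict : ∀ t ∈ Ico 0 T₀, m * B t < 1 → ∀ l ∈ Ioo (0:ℝ) 1,
      J 0 * (1 - l * m * B t) ^ (-(2 / (p - 1))) ≤ J t := by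
    intro t ht hmt l hl
    rcases ht.1.eq_or_lt with rfl | htpos
    · simp [hB0]
    have hlm : 0 < l * m := mul_pos hl.1 hm
    have hlm' : l * m < m := mul_lt_of_lt_one_left hm hl.2
    have hBs : ∀ s ∈ Icc 0 t, l * m * B s < 1 := fun s hs =>
      calc l * m * B s ≤ m * B s := mul_le_mul_of_nonneg_right hlm'.le (hBnonneg s hs.1)
        _ ≤ m * B t := mul_le_mul_of_nonneg_left (hBmono.monotoneOn hs.1 ht.1 hs.2) hm.le
        _ < 1 := hmt
    refine (profile_lt_of_damped_inequality htpos hp (fun s hs => hbpos s hs.1)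
      (fun s hs => (hbder s hs.1).mono Icc_subset_Ici_self)
      (fun s hs => (hBder s hs.1).mono Icc_subset_Ici_self) hB0 (hJd t ht) (hJd' t ht) hJ0 hγ
      (fun s hs => hineq s (hsubJ t ht hs)) (fun s hs => by linarith [hBs s hs]) ?_ ?_).le
    · intro s hs
      rw [← hδ]
      refine subsolution_coeff_le (A := A₁) (b0 := b 0) hp hβ.2 hb₁ hb₃ hB₄ hεpos hε1 hlm
        (by rw [← hμ]; exact hlm'.le) hs.1 ?_ (hblow s hs.1) (hb'bound s hs.1)
        (by linarith [hBs s hs]) (by linarith [mul_nonneg hlm.le (hBnonneg s hs.1)])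
      intro hβpos
      have h1 := hBinv_bound hβpos (B s) (hBnonneg s hs.1)
      rw [hBinv_left s hs.1] at h1
      have h2 : B s ≤ (l * m)⁻¹ := by
        rw [← one_div, le_div_iff₀ hlm]
        linarith [hBs s hs]
      have := hBnonneg s hs.1
      exact h1.trans (by gcongr)
    · refine lt_of_lt_of_le ?_ hslope
      gcongr
  have hbound : ∀ t ∈ Ico 0 T₀, m * B t < 1 →
      J 0 * (1 - m * B t) ^ (-(2 / (p - 1))) ≤ J t := by
    intro t ht hmt
    have hcont : ContinuousAt (fun l : ℝ => J 0 * (1 - l * m * B t) ^ (-(2 / (p - 1)))) 1 := by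
      refine continuousAt_const.mul (ContinuousAt.rpow_const (by fun_prop) (Or.inl ?_))
      rw [one_mul]
      exact (sub_pos.2 hmt).ne'
    have hlim := hcont.continuousWithinAt (s := Iio 1)
    rw [ContinuousWithinAt, one_mul] at hlim
    refine le_of_tendsto hlim ?_
    filter_upwards [Ioo_mem_nhdsLT (zero_lt_one (α := ℝ))] with l hl using hstrict t ht hmt l hl
  obtain ⟨hS0, hBS⟩ := hBinv_right m⁻¹ (by positivity)
  have hlt : ∀ t, 0 ≤ t → t < Binv m⁻¹ → m * B t < 1 := by
    intro t ht htS
    have := hBmono ht hS0 htS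
    rw [hBS, ← one_div, lt_div_iff₀ hm] at this
    linarith
  have hlife : T₀ ≤ Binv m⁻¹ := by
    by_contra! hcon
    have hSpos : 0 < Binv m⁻¹ := by
      rcases hS0.eq_or_lt with h | h
      · rw [← h, hB0] at hBS
        exact absurd hBS (inv_pos.2 hm).ne
      · exact h
    set S := Binv m⁻¹
    have hk : 0 < 2 / (p - 1) := by positivity
    have hnear : Ioo 0 S ∈ nhdsWithin S (Iio S) := Ioo_mem_nhdsLT hSpos
    have hle : nhdsWithin S (Iio S) ≤ nhdsWithin S (Ico 0 T₀) := by
      refine nhdsWithin_le_of_mem (Filter.mem_of_superset hnear fun x hx => ⟨hx.1.le, hx.2.trans hcon⟩)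
    have hle' : nhdsWithin S (Iio S) ≤ nhdsWithin S (Ici 0) :=
      nhdsWithin_le_of_mem (Filter.mem_of_superset hnear fun x hx => hx.1.le)
    have hJlim : Filter.Tendsto J (nhdsWithin S (Iio S)) (nhds (J S)) :=
      ((hJ_der S ⟨hS0, hcon⟩).continuousWithinAt).mono_left hle
    have hBlim : Filter.Tendsto B (nhdsWithin S (Iio S)) (nhds m⁻¹) := by
      rw [← hBS]
      exact ((hBder S hS0).continuousWithinAt).mono_left hle'
    have hxlim : Filter.Tendsto (fun t => (1 - m * B t) ^ (2 / (p - 1))) (nhdsWithin S (Iio S)) (nhds 0) := by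
      have h := ((hBlim.const_mul m).const_sub 1).rpow_const (p := 2 / (p - 1)) (Or.inr hk.le)
      rwa [mul_inv_cancel₀ hm.ne', sub_self, Real.zero_rpow hk.ne'] at h
    have hlim := hJlim.mul hxlim
    rw [mul_zero] at hlim
    refine hJ0.not_ge (ge_of_tendsto hlim ?_)
    filter_upwards [hnear] with t ht
    have hmt := hlt t ht.1.le ht.2
    have hx : 0 < 1 - m * B t := sub_pos.2 hmt
    have h := mul_le_mul_of_nonneg_right (hbound t ⟨ht.1.le, ht.2.trans hcon⟩ hmt)
      (Real.rpow_nonneg hx.le (2 / (p - 1)))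
    rwa [mul_assoc, ← Real.rpow_add hx, neg_add_cancel, Real.rpow_zero, mul_one] at h
  exact ⟨hJpos, fun t ht => hbound t ht (hlt t ht.1 (ht.2.trans_le hlife)), hlife⟩
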